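/- arXiv:1510.05933 — 5 statements merged into one kernel-verified Lean document; each statement's English description precedes it below -/
import Mathlib

section
/- Let Λ ⊆ M be a compact invariant set for the homeomorphism f. Suppose W is an open neighborhood of Λ on which f is expansive with constant a > 0, and suppose δ > 0 is such that every δ-pseudo-orbit contained in Λ is (a/2)-shadowed by some point of M. If sh(Λ, δ) = Λ, then Λ is locally maximal. -/
/-- The `n`-th iterate (`n : ℤ`) of a homeomorphism. -/
def hIter {M : Type*} [TopologicalSpace M] (f : M ≃ₜ M) (n : ℤ) : M → M :=
  fun x => (((f.toEquiv : Equiv.Perm M)) ^ n) x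

/-- `y : ℤ → M` is an `ε`-pseudo-orbit for `f`. -/
def IsPseudoOrbit {M : Type*} [MetricSpace M] (f : M ≃ₜ M) (ε : ℝ) (y : ℤ → M) : Prop :=
  ∀ j : ℤ, dist (f (y j)) (y (j + 1)) < ε

/-- `x` δ-shadows the sequence `y`. -/
def Shadows {M : Type*} [MetricSpace M] (f : M ≃ₜ M) (δ : ℝ) (x : M) (y : ℤ → M) : Prop :=
  ∀ j : ℤ, dist (hIter f j x) (y j) ≤ δ

/-- `I_f(U) = ⋂_{n ∈ ℤ} fⁿ(U)`. -/
def invSet {M : Type*} [TopologicalSpace M] (f : M ≃ₜ M) (U : Set M) : Set M :=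
  ⋂ n : ℤ, hIter f n '' U

/-- A compact invariant set is locally maximal if it is the maximal invariant
set of some open neighborhood. -/
def LocallyMaximal {M : Type*} [TopologicalSpace M] (f : M ≃ₜ M) (Λ : Set M) : Prop :=
  ∃ U : Set M, IsOpen U ∧ Λ ⊆ U ∧ Λ = invSet f U

/-- `Λ` is premaximal: every open neighborhood contains a compact invariant
locally maximal set containing `Λ`. -/
def Premaximal {M : Type*} [TopologicalSpace M] (f : M ≃ₜ M) (Λ : Set M) : Prop :=
  ∀ U : Set M, IsOpen U → Λ ⊆ U →
    ∃ Λ' : Set M, IsCompact Λ' ∧ f '' Λ' = Λ' ∧ LocallyMaximal f Λ' ∧ Λ ⊆ Λ' ∧ Λ' ⊆ U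

/-- `f` is expansive with constant `a` on `W`. -/
def ExpansiveOn {M : Type*} [MetricSpace M] (f : M ≃ₜ M) (a : ℝ) (W : Set M) : Prop :=
  ∀ x y : M, (∀ n : ℤ, hIter f n x ∈ W) → (∀ n : ℤ, hIter f n y ∈ W) →
    (∀ n : ℤ, dist (hIter f n x) (hIter f n y) ≤ a) → x = y

/-- `W` has the shadowing property. -/
def HasShadowing {M : Type*} [MetricSpace M] (f : M ≃ₜ M) (W : Set M) : Prop :=
  ∀ ε > (0 : ℝ), ∃ δ > (0 : ℝ), ∀ y : ℤ → M, IsPseudoOrbit f δ y → (∀ j, y j ∈ W) →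
    ∃ x : M, Shadows f ε x y

/-- The shadowing closure `sh(Λ, δ)` (with expansivity constant `a`). -/
def shClosure {M : Type*} [MetricSpace M] (f : M ≃ₜ M) (a δ : ℝ) (Λ : Set M) : Set M :=
  closure {x : M | ∃ y : ℤ → M, IsPseudoOrbit f δ y ∧ (∀ j, y j ∈ Λ) ∧ Shadows f (a / 2) x y}

/-- The shadowing sequence `Λ₀ = Λ`, `Λ_{j+1} = sh(Λ_j, δ)`. -/
def shSeq {M : Type*} [MetricSpace M] (f : M ≃ₜ M) (a δ : ℝ) (Λ : Set M) : ℕ → Set M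
  | 0 => Λ
  | j + 1 => shClosure f a δ (shSeq f a δ Λ j)

/-- Iterates of a homeomorphism preserve an invariant set. -/
theorem hIter_mem_of_image_eq {M : Type*} [TopologicalSpace M] {f : M ≃ₜ M} {Λ : Set M}
    (hΛ : f '' Λ = Λ) (n : ℤ) {x : M} (hx : x ∈ Λ) : hIter f n x ∈ Λ := by
  have forward : ∀ z ∈ Λ, f z ∈ Λ := fun z hz => hΛ ▸ Set.mem_image_of_mem f hz
  have backward : ∀ z ∈ Λ, f.symm z ∈ Λ := by
    intro z hz
    rw [← hΛ] at hz
    obtain ⟨w, hw, rfl⟩ := hz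
    simpa using hw
  induction n using Int.induction_on with
  | zero => simpa [hIter] using hx
  | succ k ih =>
    have h := forward _ ih
    rwa [hIter, add_comm, zpow_add, zpow_one]
  | pred k ih =>
    have h := backward _ ih
    rwa [hIter, sub_eq_neg_add, zpow_add, zpow_neg_one]

theorem hIter_succ {M : Type*} [TopologicalSpace M] (f : M ≃ₜ M) (n : ℤ) (x : M) :
    hIter f (n + 1) x = f (hIter f n x) := by
  rw [hIter, add_comm, zpow_add, zpow_one]
  rfl

theorem hIter_hIter_neg {M : Type*} [TopologicalSpace M] (f : M ≃ₜ M) (n : ℤ) (x : M) :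
    hIter f n (hIter f (-n) x) = x := by
  simp [hIter]

theorem mem_invSet_iff {M : Type*} [TopologicalSpace M] {f : M ≃ₜ M} {U : Set M} {x : M} :
    x ∈ invSet f U ↔ ∀ n : ℤ, hIter f n x ∈ U := by
  simp only [invSet, Set.mem_iInter]
  constructor
  · intro h n
    obtain ⟨u, hu, rfl⟩ := h (-n)
    have := hIter_hIter_neg f n u
    rwa [this]
  · exact fun h n => ⟨hIter f (-n) x, h (-n), hIter_hIter_neg f n x⟩

/-- if `sh(Λ, δ) = Λ` then `Λ` is locally maximal. -/
theorem locallyMaximal_of_shClosure_eq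
    {M : Type*} [MetricSpace M] [CompactSpace M] (f : M ≃ₜ M)
    (Λ W : Set M) (a δ : ℝ)
    (hΛc : IsCompact Λ) (hΛinv : f '' Λ = Λ)
    (hW : IsOpen W) (hΛW : Λ ⊆ W)
    (ha : 0 < a) (hexp : ExpansiveOn f a W)
    (hδ : 0 < δ)
    (hδshad : ∀ y : ℤ → M, IsPseudoOrbit f δ y → (∀ j, y j ∈ Λ) →
      ∃ x : M, Shadows f (a / 2) x y)
    (hsh : shClosure f a δ Λ = Λ) :
    LocallyMaximal f Λ := by
  obtain ⟨η, hη, hfη⟩ := Metric.uniformContinuous_iff.mp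
    (CompactSpace.uniformContinuous_of_continuous f.continuous) (δ / 2) (half_pos hδ)
  set r := min η (min (δ / 2) (a / 2)) with hr
  have hr_pos : 0 < r := by positivity
  have hrη : r ≤ η := min_le_left _ _
  have hrδ : r ≤ δ / 2 := (min_le_right _ _).trans (min_le_left _ _)
  have hra : r ≤ a / 2 := (min_le_right _ _).trans (min_le_right _ _)
  have hsub : Λ ⊆ Metric.thickening r Λ := Metric.self_subset_thickening hr_pos Λ
  refine ⟨Metric.thickening r Λ, Metric.isOpen_thickening, hsub, Set.Subset.antisymm ?_ ?_⟩
  · exact fun x hx => mem_invSet_iff.mpr fun n => hsub (hIter_mem_of_image_eq hΛinv n hx)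
  · intro x hx
    choose y hyΛ hy using fun n => Metric.mem_thickening_iff.mp (mem_invSet_iff.mp hx n)
    rw [← hsh]
    refine subset_closure ⟨y, fun j => ?_, hyΛ, fun j => (hy j).le.trans hra⟩
    have hstep : dist (f (y j)) (hIter f (j + 1) x) < δ / 2 := by
      rw [hIter_succ]
      exact hfη (by rw [dist_comm]; exact (hy j).trans_le hrη)
    linarith [dist_triangle (f (y j)) (hIter f (j + 1) x) (y (j + 1)), hy (j + 1)]
end

section
/- Let Λ ⊆ M be a compact invariant set for the homeomorphism f. Suppose W is an open neighborhood of Λ on which f is expansive with constant a > 0, let δ ∈ (0, a/2), and let (Λ_j) be the shadowing sequence of Λ with parameter δ; assume every Λ_j is contained in W, that every δ-pseudo-orbit contained in W is (a/2)-shadowed by some point of M, and set ν_j = d_H(Λ_{j+1}, Λ_j). Let γ ∈ (0, δ/8) be such that d(x, y) < 2γ implies d(f(x), f(y)) < δ/4 and d(f⁻¹(x), f⁻¹(y)) < δ/4. Then for every j, if Λ_{j+1} ≠ Λ_{j+2}, then ν_j ≥ γ or ν_{j+1} ≥ γ or ν_{j+2} ≥ γ. -/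
theorem hIter_add {M : Type*} [TopologicalSpace M] (f : M ≃ₜ M) (m n : ℤ) (x : M) :
    hIter f (m + n) x = hIter f m (hIter f n x) := by
  simp [hIter, zpow_add]

theorem hIter_zero {M : Type*} [TopologicalSpace M] (f : M ≃ₜ M) (x : M) :
    hIter f 0 x = x := by
  simp [hIter]

theorem hIter_one {M : Type*} [TopologicalSpace M] (f : M ≃ₜ M) (x : M) :
    hIter f 1 x = f x := by
  simp [hIter]

theorem apply_hIter {M : Type*} [TopologicalSpace M] (f : M ≃ₜ M) (n : ℤ) (x : M) :
    f (hIter f n x) = hIter f (n + 1) x := by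
  rw [add_comm, hIter_add, hIter_one]

theorem hIter_neg_one {M : Type*} [TopologicalSpace M] (f : M ≃ₜ M) (x : M) :
    hIter f (-1) x = f.symm x := by
  rw [Homeomorph.eq_symm_apply, apply_hIter, neg_add_cancel, hIter_zero]

theorem continuous_hIter {M : Type*} [TopologicalSpace M] (f : M ≃ₜ M) (n : ℤ) :
    Continuous (hIter f n) := by
  induction n using Int.induction_on with
  | zero => exact continuous_id.congr fun x => (hIter_zero f x).symm
  | succ n ih => exact (f.continuous.comp ih).congr fun x => apply_hIter f n x
  | pred n ih =>
    refine (f.symm.continuous.comp ih).congr fun x => ?_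
    rw [Function.comp_apply, ← hIter_neg_one, ← hIter_add]
    congr 1
    ring

/-- Every shadowing closure is invariant under all iterates of `f`. -/
theorem mapsTo_hIter_shClosure {M : Type*} [MetricSpace M] (f : M ≃ₜ M) (a δ : ℝ)
    (S : Set M) (n : ℤ) :
    Set.MapsTo (hIter f n) (shClosure f a δ S) (shClosure f a δ S) := by
  refine Set.MapsTo.closure ?_ (continuous_hIter f n)
  rintro x ⟨y, hy, hyS, hxy⟩
  refine ⟨fun j => y (j + n), fun j => ?_, fun j => hyS _, fun j => ?_⟩
  · simpa only [add_right_comm] using hy (j + n)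
  · simpa only [hIter_add] using hxy (j + n)

/-- A point whose whole orbit stays `η`-close to `S` lies in the shadowing closure of `S`, as soon
as `η` is small and `η`-close points have close images. -/
theorem mem_shClosure_of_orbit_close {M : Type*} [MetricSpace M] {f : M ≃ₜ M} {a δ η ε : ℝ}
    {S : Set M} {x : M} (hηa : η ≤ a / 2) (hεη : ε + η ≤ δ)
    (hf : ∀ u v : M, dist u v < η → dist (f u) (f v) < ε)
    (hx : ∀ n : ℤ, ∃ z ∈ S, dist (hIter f n x) z < η) :
    x ∈ shClosure f a δ S := by
  choose z hzS hz using hx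
  refine subset_closure ⟨z, fun n => ?_, hzS, fun n => (hz n).le.trans hηa⟩
  have h₁ : dist (f (z n)) (f (hIter f n x)) < ε := hf _ _ (by rw [dist_comm]; exact hz n)
  rw [apply_hIter] at h₁
  linarith [hz (n + 1), dist_triangle (f (z n)) (hIter f (n + 1) x) (z (n + 1))]

theorem nonempty_of_shClosure_nonempty {M : Type*} [MetricSpace M] {f : M ≃ₜ M} {a δ : ℝ}
    {S : Set M} (h : (shClosure f a δ S).Nonempty) : S.Nonempty := by
  obtain ⟨_, y, _, hyS, _⟩ := closure_nonempty_iff.mp h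
  exact ⟨y 0, hyS 0⟩

/-- In a compact space, the points of a shadowing closure `r`-close to `S` in the Hausdorff
distance are within `r` of points of `S`. -/
theorem exists_dist_lt_of_hausdorffDist_shClosure_lt {M : Type*} [MetricSpace M] [CompactSpace M]
    {f : M ≃ₜ M} {a δ r : ℝ} {S : Set M} {x : M} (hx : x ∈ shClosure f a δ S)
    (hr : Metric.hausdorffDist (shClosure f a δ S) S < r) : ∃ z ∈ S, dist x z < r :=
  Metric.exists_dist_lt_of_hausdorffDist_lt hx hr
    (Metric.hausdorffEDist_ne_top_of_nonempty_of_bounded ⟨x, hx⟩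
      (nonempty_of_shClosure_nonempty ⟨x, hx⟩) (Metric.isBounded_of_compactSpace)
      (Metric.isBounded_of_compactSpace))

/-- if consecutive terms of the shadowing sequence differ, then one of the
three consecutive Hausdorff gaps is at least `γ`. -/
theorem shadowing_sequence_hausdorff_gap
    {M : Type*} [MetricSpace M] [CompactSpace M] (f : M ≃ₜ M)
    (Λ W : Set M) (a δ γ : ℝ)
    (hΛc : IsCompact Λ) (hΛinv : f '' Λ = Λ)
    (hW : IsOpen W) (hΛW : Λ ⊆ W)
    (ha : 0 < a) (hexp : ExpansiveOn f a W)
    (hδ : 0 < δ) (hδa : δ < a / 2)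
    (hseqW : ∀ j : ℕ, shSeq f a δ Λ j ⊆ W)
    (hshadW : ∀ y : ℤ → M, IsPseudoOrbit f δ y → (∀ j, y j ∈ W) →
      ∃ x : M, Shadows f (a / 2) x y)
    (hγ : 0 < γ) (hγδ : γ < δ / 8)
    (hunif : ∀ x y : M, dist x y < 2 * γ →
      dist (f x) (f y) < δ / 4 ∧ dist (f.symm x) (f.symm y) < δ / 4) :
    ∀ j : ℕ, shSeq f a δ Λ (j + 1) ≠ shSeq f a δ Λ (j + 2) →
      γ ≤ Metric.hausdorffDist (shSeq f a δ Λ (j + 1)) (shSeq f a δ Λ j) ∨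
      γ ≤ Metric.hausdorffDist (shSeq f a δ Λ (j + 2)) (shSeq f a δ Λ (j + 1)) ∨
      γ ≤ Metric.hausdorffDist (shSeq f a δ Λ (j + 3)) (shSeq f a δ Λ (j + 2)) := by
  intro j hne
  by_contra! hlt
  obtain ⟨h₀, h₁, -⟩ := hlt
  refine hne (Set.Subset.antisymm (fun x hx => ?_) fun x hx => ?_)
  · refine mem_shClosure_of_orbit_close (η := 2 * γ) (ε := δ / 4) (by linarith) (by linarith)
      (fun u v huv => (hunif u v huv).1) fun n =>
        ⟨hIter f n x, mapsTo_hIter_shClosure f a δ _ n hx, by rw [dist_self]; linarith⟩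
  · refine mem_shClosure_of_orbit_close (η := 2 * γ) (ε := δ / 4) (by linarith) (by linarith)
      (fun u v huv => (hunif u v huv).1) fun n => ?_
    obtain ⟨y, hy, hxy⟩ := exists_dist_lt_of_hausdorffDist_shClosure_lt
      (mapsTo_hIter_shClosure f a δ _ n hx) h₁
    obtain ⟨z, hz, hyz⟩ := exists_dist_lt_of_hausdorffDist_shClosure_lt hy h₀
    exact ⟨z, hz, by linarith [dist_triangle (hIter f n x) y z]⟩
end

section
/- If Λ ⊆ Ω is closed, σ-invariant, and locally maximal for σ, then there exist k ≥ 1 and a set W ⊆ A^k of words of length k such that Λ = M_W. -/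
/-- The shift map on `Ω = (Fin n)^ℤ`. -/
def shiftMap (n : ℕ) : (ℤ → Fin n) → (ℤ → Fin n) := fun a i => a (i + 1)

/-- The `m`-th power (`m : ℤ`) of the shift map. -/
def shiftPow (n : ℕ) (m : ℤ) : (ℤ → Fin n) → (ℤ → Fin n) := fun a i => a (i + m)

/-- `Λ` is locally maximal for the shift: it is the largest invariant set of some
open neighborhood. -/
def ShiftLocallyMaximal (n : ℕ) (Λ : Set (ℤ → Fin n)) : Prop :=
  ∃ U : Set (ℤ → Fin n), IsOpen U ∧ Λ ⊆ U ∧ Λ = ⋂ m : ℤ, shiftPow n m '' U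

/-- The subshift `M_W` determined by a set `W` of admissible words of length `k`. -/
def wordSet (n k : ℕ) (W : Set (Fin k → Fin n)) : Set (ℤ → Fin n) :=
  {a : ℤ → Fin n | ∀ i : ℤ, (fun j : Fin k => a (i + (j : ℤ))) ∈ W}

theorem isOpen_pi_Icc_singleton {α : Type*} [TopologicalSpace α] [DiscreteTopology α]
    (a : ℤ → α) (N : ℕ) :
    IsOpen ((Set.Icc (-(N : ℤ)) N).pi fun i => ({a i} : Set α)) :=
  isOpen_set_pi (Set.finite_Icc _ _) fun _ _ => isOpen_discrete _

/-- Every point of an open set has a central cylinder contained in the set. -/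
theorem exists_pi_Icc_singleton_subset {α : Type*} [TopologicalSpace α]
    {U : Set (ℤ → α)} (hU : IsOpen U) {a : ℤ → α} (ha : a ∈ U) :
    ∃ N : ℕ, (Set.Icc (-(N : ℤ)) N).pi (fun i => ({a i} : Set α)) ⊆ U := by
  obtain ⟨I, u, hu, hsub⟩ := isOpen_pi_iff.1 hU a ha
  refine ⟨I.sup Int.natAbs, fun b hb => hsub fun i hi => ?_⟩
  have hle : i.natAbs ≤ I.sup Int.natAbs := Finset.le_sup (f := Int.natAbs) hi
  have hbi : b i = a i := hb i ⟨by omega, by omega⟩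
  exact hbi ▸ (hu i hi).2

/-- Around a compact subset of an open set, the central cylinders contained in the open set
can be chosen of uniform length. -/
theorem IsCompact.exists_pi_Icc_singleton_subset {α : Type*} [TopologicalSpace α]
    [DiscreteTopology α] {K U : Set (ℤ → α)} (hK : IsCompact K) (hU : IsOpen U) (hKU : K ⊆ U) :
    ∃ N : ℕ, ∀ a ∈ K, (Set.Icc (-(N : ℤ)) N).pi (fun i => ({a i} : Set α)) ⊆ U := by
  let V : ℕ → Set (ℤ → α) :=
    fun N => {a | (Set.Icc (-(N : ℤ)) N).pi (fun i => ({a i} : Set α)) ⊆ U}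
  have hopen : ∀ N, IsOpen (V N) := fun N => isOpen_iff_forall_mem_open.2 fun a ha =>
    ⟨(Set.Icc (-(N : ℤ)) N).pi fun i => {a i},
      fun b hb c hc => ha fun i hi => (hc i hi).trans (hb i hi),
      isOpen_pi_Icc_singleton a N, fun _ _ => rfl⟩
  have hmono : Monotone V := fun M N hMN a ha b hb =>
    ha fun i hi => hb i ⟨by have := hi.1; omega, by have := hi.2; omega⟩
  exact hK.elim_directed_cover V hopen
    (fun a ha => Set.mem_iUnion.2 (_root_.exists_pi_Icc_singleton_subset hU (hKU ha)))
    hmono.directed_le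

theorem shiftPow_mem_of_image_shiftMap_eq {n : ℕ} {Λ : Set (ℤ → Fin n)}
    (hinv : shiftMap n '' Λ = Λ) {a : ℤ → Fin n} (ha : a ∈ Λ) (m : ℤ) :
    shiftPow n m a ∈ Λ := by
  induction m using Int.induction_on with
  | zero =>
    convert ha using 1
    funext i
    simp [shiftPow]
  | succ m ih =>
    rw [← hinv]
    refine ⟨_, ih, ?_⟩
    funext i
    simp only [shiftMap, shiftPow]
    congr 1
    ring
  | pred m ih =>
    rw [← hinv] at ih
    obtain ⟨b, hb, hba⟩ := ih
    convert hb using 1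
    funext i
    have h := congrFun hba (i - 1)
    simp only [shiftMap, shiftPow, sub_add_cancel] at h
    rw [h, shiftPow]
    congr 1
    ring

/-- every closed, shift-invariant, locally maximal set is a subshift of
finite type `M_W`. -/
theorem locallyMaximal_eq_wordSet
    (n : ℕ) (hn : 1 ≤ n) (Λ : Set (ℤ → Fin n))
    (hclosed : IsClosed Λ) (hinv : shiftMap n '' Λ = Λ)
    (hmax : ShiftLocallyMaximal n Λ) :
    ∃ k : ℕ, 1 ≤ k ∧ ∃ W : Set (Fin k → Fin n), Λ = wordSet n k W := by
  obtain ⟨U, hU, hΛU, hΛ⟩ := hmax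
  obtain ⟨N, hN⟩ := hclosed.isCompact.exists_pi_Icc_singleton_subset hU hΛU
  refine ⟨2 * N + 1, by omega,
    {w | ∃ a ∈ Λ, ∀ j : Fin (2 * N + 1), w j = a ((j : ℤ) - N)}, Set.Subset.antisymm ?_ ?_⟩
  · intro a ha i
    refine ⟨_, shiftPow_mem_of_image_shiftMap_eq hinv ha (i + N), fun j => ?_⟩
    simp only [shiftPow]
    congr 1
    ring
  · intro b hb
    rw [hΛ, Set.mem_iInter]
    intro m
    refine ⟨shiftPow n (-m) b, ?_, by funext i; simp [shiftPow]⟩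
    obtain ⟨a, ha, hab⟩ := hb (-m - N)
    refine hN a ha fun i hi => ?_
    obtain ⟨hi₁, hi₂⟩ := hi
    have h := hab ⟨(i + N).toNat, by omega⟩
    have hcast : ((i + N).toNat : ℤ) = i + N := Int.toNat_of_nonneg (by omega)
    simp only [hcast, add_sub_cancel_right] at h
    rw [Set.mem_singleton_iff, ← h, shiftPow]
    congr 1
    ring
end

section
/- Every closed σ-invariant set Λ ⊆ Ω is premaximal for σ: for every open set U with Λ ⊆ U there exist k ≥ 1 and a set W ⊆ A^k of words of length k such that Λ ⊆ M_W ⊆ U; in particular, M_W is a closed σ-invariant locally maximal set containing Λ and contained in U. -/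
theorem image_shiftPow {n : ℕ} (m : ℤ) (S : Set (ℤ → Fin n)) :
    shiftPow n m '' S = shiftPow n (-m) ⁻¹' S := by
  refine congrFun (Set.image_eq_preimage_of_inverse ?_ ?_) S <;> intro a <;> funext i <;> simp [shiftPow]

/-- A compact subset of an open set `U` has a uniform window `[-N, N]` on which agreement with
one of its points forces membership in `U`. -/
theorem IsCompact.exists_window_subset {n : ℕ} {Λ U : Set (ℤ → Fin n)} (hΛ : IsCompact Λ)
    (hU : IsOpen U) (hΛU : Λ ⊆ U) :
    ∃ N : ℕ, ∀ a ∈ Λ, ∀ b : ℤ → Fin n, (∀ i : ℤ, |i| ≤ N → b i = a i) → b ∈ U := by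
  have union_window {s t : Set (ℤ → Fin n)}
      (hs : ∃ N : ℕ, ∀ a ∈ s, ∀ b : ℤ → Fin n, (∀ i : ℤ, |i| ≤ N → b i = a i) → b ∈ U)
      (ht : ∃ N : ℕ, ∀ a ∈ t, ∀ b : ℤ → Fin n, (∀ i : ℤ, |i| ≤ N → b i = a i) → b ∈ U) :
      ∃ N : ℕ, ∀ a ∈ s ∪ t, ∀ b : ℤ → Fin n, (∀ i : ℤ, |i| ≤ N → b i = a i) → b ∈ U := by
    obtain ⟨M, hM⟩ := hs
    obtain ⟨N, hN⟩ := ht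
    refine ⟨max M N, ?_⟩
    rintro a (ha | ha) b hb
    · exact hM a ha b fun i hi => hb i (hi.trans (by simp))
    · exact hN a ha b fun i hi => hb i (hi.trans (by simp))
  refine hΛ.induction_on ⟨0, by simp⟩ (fun s t hst ⟨N, hN⟩ => ⟨N, fun a ha => hN a (hst ha)⟩)
    (fun _ _ => union_window) fun a ha => ?_
  obtain ⟨I, u, hu, hIU⟩ := isOpen_pi_iff.1 hU a (hΛU ha)
  refine ⟨(I : Set ℤ).pi fun i => {a i}, mem_nhdsWithin_of_mem_nhds
    (set_pi_mem_nhds I.finite_toSet fun i _ => by simp), I.sup Int.natAbs, fun c hc b hb => ?_⟩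
  refine hIU fun i hi => ?_
  have hi' : |i| ≤ (I.sup Int.natAbs : ℕ) := by
    rw [Int.abs_eq_natAbs]
    exact_mod_cast Finset.le_sup (f := Int.natAbs) hi
  rw [hb i hi', hc i hi]
  exact (hu i hi).2

theorem isClopen_setOf_word_mem {n k : ℕ} (W : Set (Fin k → Fin n)) (i : ℤ) :
    IsClopen {a : ℤ → Fin n | (fun j : Fin k => a (i + (j : ℤ))) ∈ W} :=
  (isClopen_discrete W).preimage (by fun_prop)

theorem isClosed_wordSet {n k : ℕ} (W : Set (Fin k → Fin n)) : IsClosed (wordSet n k W) := by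
  simp only [wordSet, Set.ofPred_forall]
  exact isClosed_iInter fun i => (isClopen_setOf_word_mem W i).isClosed

theorem shiftPow_mem_wordSet {n k : ℕ} {W : Set (Fin k → Fin n)} {a : ℤ → Fin n}
    (ha : a ∈ wordSet n k W) (m : ℤ) : shiftPow n m a ∈ wordSet n k W := by
  intro i
  convert ha (i + m) using 2
  simp only [shiftPow]
  congr 1
  ring

theorem image_shiftMap_wordSet {n k : ℕ} (W : Set (Fin k → Fin n)) :
    shiftMap n '' wordSet n k W = wordSet n k W := by
  change shiftPow n 1 '' wordSet n k W = wordSet n k W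
  refine Set.Subset.antisymm (Set.image_subset_iff.2 fun a ha => shiftPow_mem_wordSet ha 1) ?_
  rw [image_shiftPow]
  exact fun a ha => shiftPow_mem_wordSet ha (-1)

theorem shiftLocallyMaximal_wordSet {n k : ℕ} (W : Set (Fin k → Fin n)) :
    ShiftLocallyMaximal n (wordSet n k W) := by
  refine ⟨_, (isClopen_setOf_word_mem W 0).isOpen, fun a ha => ha 0, ?_⟩
  ext a
  simp only [image_shiftPow, Set.mem_iInter, Set.mem_preimage, Set.mem_ofPred_eq, wordSet,
    shiftPow, zero_add]
  rw [(Equiv.neg ℤ).surjective.forall]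
  simp only [Equiv.neg_apply, add_comm]

/-- every closed shift-invariant set is premaximal for the shift: every
open neighborhood contains an intermediate subshift of finite type `M_W`, which is
closed, shift-invariant and locally maximal. -/
theorem shift_invariant_premaximal
    (n : ℕ) (hn : 1 ≤ n) (Λ : Set (ℤ → Fin n))
    (hclosed : IsClosed Λ) (hinv : shiftMap n '' Λ = Λ) :
    ∀ U : Set (ℤ → Fin n), IsOpen U → Λ ⊆ U →
      ∃ k : ℕ, 1 ≤ k ∧ ∃ W : Set (Fin k → Fin n),
        Λ ⊆ wordSet n k W ∧ wordSet n k W ⊆ U ∧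
        IsClosed (wordSet n k W) ∧
        shiftMap n '' wordSet n k W = wordSet n k W ∧
        ShiftLocallyMaximal n (wordSet n k W) := by
  intro U hU hΛU
  obtain ⟨N, hN⟩ := hclosed.isCompact.exists_window_subset hU hΛU
  refine ⟨2 * N + 1, by omega, (fun a j => a ((j : ℤ) - N)) '' Λ, ?_, ?_, isClosed_wordSet _,
    image_shiftMap_wordSet _, shiftLocallyMaximal_wordSet _⟩
  · intro a ha i
    refine ⟨_, shiftPow_mem_of_image_shiftMap_eq hinv ha (i + N), funext fun j => ?_⟩
    simp only [shiftPow]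
    congr 1
    ring
  · intro b hb
    obtain ⟨a, ha, hab⟩ := hb (-N)
    refine hN a ha b fun i hi => ?_
    rw [abs_le] at hi
    have h := congrFun hab ⟨(i + N).toNat, by omega⟩
    have hcast : ((i + N).toNat : ℤ) = i + N := Int.toNat_of_nonneg (by omega)
    simp only [hcast, add_sub_cancel_right, neg_add_cancel_comm_assoc] at h
    exact h.symm
end

section
/- Let φ be a continuous flow on a compact metric space M, let Λ be a compact invariant set, and let W be an open neighborhood of Λ on which φ is expansive with constants a, τ₀ > 0. Then there exist δ, δ₁, ε > 0 such that: whenever g₁ and g₂ are δ-pseudotrajectories with values in Λ that are δ₁-rep-close, and x₁ ε-shadows g₁ and x₂ ε-shadows g₂, there exists τ ∈ (−τ₀, τ₀) with x₂ = φ(τ, x₁). -/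
/-- An increasing homeomorphism of `ℝ` (a reparameterization). -/
def Reparam (γ : ℝ → ℝ) : Prop :=
  StrictMono γ ∧ Continuous γ ∧ Function.Surjective γ

/-- `Λ` is invariant under the flow `φ`. -/
def FlowInvariant {M : Type*} [TopologicalSpace M] (φ : Flow ℝ M) (Λ : Set M) : Prop :=
  ∀ t : ℝ, φ t '' Λ = Λ

/-- The orbit of `x` under the flow `φ`. -/
def flowOrbit {M : Type*} [TopologicalSpace M] (φ : Flow ℝ M) (x : M) : Set M :=
  Set.range fun t : ℝ => φ t x

/-- `I_φ(U) = ⋂_{t ∈ ℝ} φ_t(U)`. -/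
def flowInvSet {M : Type*} [TopologicalSpace M] (φ : Flow ℝ M) (U : Set M) : Set M :=
  ⋂ t : ℝ, φ t '' U

/-- A compact invariant set is locally maximal for the flow `φ` if it is the maximal
invariant set of some open neighborhood. -/
def FlowLocallyMaximal {M : Type*} [TopologicalSpace M] (φ : Flow ℝ M) (Λ : Set M) : Prop :=
  ∃ U : Set M, IsOpen U ∧ Λ ⊆ U ∧ Λ = flowInvSet φ U

/-- `Λ` is premaximal for the flow `φ`. -/
def FlowPremaximal {M : Type*} [TopologicalSpace M] (φ : Flow ℝ M) (Λ : Set M) : Prop :=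
  ∀ U : Set M, IsOpen U → Λ ⊆ U →
    ∃ Λ' : Set M, IsCompact Λ' ∧ FlowInvariant φ Λ' ∧ FlowLocallyMaximal φ Λ' ∧
      Λ ⊆ Λ' ∧ Λ' ⊆ U

/-- `g : ℝ → M` is an `ε`-pseudotrajectory for the flow `φ`. -/
def IsPseudoTraj {M : Type*} [MetricSpace M] (φ : Flow ℝ M) (ε : ℝ) (g : ℝ → M) : Prop :=
  ∀ t τ : ℝ, |τ| < 1 → dist (g (t + τ)) (φ τ (g t)) < ε

/-- The point `x₀` δ-shadows the pseudotrajectory `g`. -/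
def FlowShadows {M : Type*} [MetricSpace M] (φ : Flow ℝ M) (δ : ℝ) (x₀ : M) (g : ℝ → M) :
    Prop :=
  ∃ α : ℝ → ℝ, Reparam α ∧ (∀ t : ℝ, dist (g t) (φ (α t) x₀) < δ) ∧
    ∀ t₁ t₂ : ℝ, t₁ ≠ t₂ → |(α t₁ - α t₂) / (t₁ - t₂) - 1| < δ

/-- The flow `φ` is expansive with constants `a, τ₀` on `W`. -/
def FlowExpansiveOn {M : Type*} [MetricSpace M] (φ : Flow ℝ M) (a τ₀ : ℝ) (W : Set M) :
    Prop :=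
  ∀ x₁ x₂ : M, (∀ t : ℝ, φ t x₁ ∈ W) → (∀ t : ℝ, φ t x₂ ∈ W) →
    (∃ β : ℝ → ℝ, Reparam β ∧ ∀ t : ℝ, dist (φ (β t) x₁) (φ t x₂) < a) →
    ∃ τ : ℝ, |τ| < τ₀ ∧ x₂ = φ τ x₁

/-- `W` has the flow shadowing property. -/
def FlowHasShadowing {M : Type*} [MetricSpace M] (φ : Flow ℝ M) (W : Set M) : Prop :=
  ∀ δ > (0 : ℝ), ∃ ε > (0 : ℝ), ∀ g : ℝ → M, IsPseudoTraj φ ε g → (∀ t, g t ∈ W) →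
    ∃ x₀ : M, FlowShadows φ δ x₀ g

/-- `Λ` and `Λ'` are conjugated via `(h, α)`: `h` is a homeomorphism of `Λ` onto `Λ'`,
`α(x, ·)` is a reparameterization depending continuously on `(x, t) ∈ Λ × ℝ`, and
`h(φ_t(x)) = φ'(α(x,t), h(x))`. -/
def ConjugatedFlows {M M' : Type*} [MetricSpace M] [MetricSpace M']
    (φ : Flow ℝ M) (φ' : Flow ℝ M') (Λ : Set M) (Λ' : Set M')
    (h : M → M') (α : M → ℝ → ℝ) : Prop :=
  ContinuousOn h Λ ∧ Set.InjOn h Λ ∧ h '' Λ = Λ' ∧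
  ContinuousOn (fun p : M × ℝ => α p.1 p.2) (Λ ×ˢ (Set.univ : Set ℝ)) ∧
  (∀ x ∈ Λ, Reparam (α x)) ∧
  (∀ x ∈ Λ, ∀ t : ℝ, h (φ t x) = φ' (α x t) (h x))

/-- points shadowing rep-close pseudotrajectories in an expansive set lie
on the same orbit up to a small time shift. -/
theorem shadowing_points_of_repClose_pseudotrajectories
    {M : Type*} [MetricSpace M] [CompactSpace M]
    (φ : Flow ℝ M) (Λ W : Set M) (a τ₀ : ℝ)
    (hΛc : IsCompact Λ) (hΛinv : FlowInvariant φ Λ)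
    (hW : IsOpen W) (hΛW : Λ ⊆ W)
    (ha : 0 < a) (hτ₀ : 0 < τ₀)
    (hexp : FlowExpansiveOn φ a τ₀ W) :
    ∃ δ > (0 : ℝ), ∃ δ₁ > (0 : ℝ), ∃ ε > (0 : ℝ),
      ∀ g₁ g₂ : ℝ → M, IsPseudoTraj φ δ g₁ → IsPseudoTraj φ δ g₂ →
        (∀ t, g₁ t ∈ Λ) → (∀ t, g₂ t ∈ Λ) →
        (∃ γ : ℝ → ℝ, Reparam γ ∧ ∀ t : ℝ, dist (g₁ t) (g₂ (γ t)) < δ₁) →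
        ∀ x₁ x₂ : M, FlowShadows φ ε x₁ g₁ → FlowShadows φ ε x₂ g₂ →
          ∃ τ : ℝ, |τ| < τ₀ ∧ x₂ = φ τ x₁ := by
  obtain ⟨ρ, hρ, hthick⟩ := hΛc.exists_thickening_subset_open hW hΛW
  refine ⟨1, one_pos, a / 4, by positivity, min ρ (a / 4), lt_min hρ (by positivity), ?_⟩
  rintro g₁ g₂ - - hg₁ hg₂ ⟨γ, hγ, hclose⟩ x₁ x₂ ⟨α₁, hα₁, hs₁, -⟩ ⟨α₂, hα₂, hs₂, -⟩
  have orbit_mem : ∀ (g : ℝ → M) (x : M) (α : ℝ → ℝ), (∀ t, g t ∈ Λ) →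
      Function.Surjective α → (∀ t, dist (g t) (φ (α t) x) < min ρ (a / 4)) →
      ∀ t, φ t x ∈ W := by
    intro g x α hg hα hs t
    obtain ⟨s, rfl⟩ := hα t
    refine hthick (Metric.mem_thickening_iff.2 ⟨g s, hg s, ?_⟩)
    rw [dist_comm]
    exact (hs s).trans_le (min_le_left _ _)
  refine hexp x₁ x₂ (orbit_mem g₁ x₁ α₁ hg₁ hα₁.2.2 hs₁) (orbit_mem g₂ x₂ α₂ hg₂ hα₂.2.2 hs₂) ?_
  let e : ℝ ≃o ℝ := StrictMono.orderIsoOfSurjective (α₂ ∘ γ) (hα₂.1.comp hγ.1)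
    (hα₂.2.2.comp hγ.2.2)
  refine ⟨α₁ ∘ e.symm, ⟨hα₁.1.comp e.symm.strictMono, hα₁.2.1.comp e.symm.continuous,
    hα₁.2.2.comp e.symm.surjective⟩, fun t => ?_⟩
  obtain ⟨s, rfl⟩ := e.surjective t
  have he : e s = α₂ (γ s) := rfl
  rw [Function.comp_apply, e.symm_apply_apply, he]
  have h₁ := (hs₁ s).trans_le (min_le_right _ _)
  have h₂ := (hs₂ (γ s)).trans_le (min_le_right _ _)
  have htri := dist_triangle4 (φ (α₁ s) x₁) (g₁ s) (g₂ (γ s)) (φ (α₂ (γ s)) x₂)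
  rw [dist_comm _ (g₁ s)] at htri
  linarith [hclose s]
end
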